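/- There exists a constant B, depending only on n, m, α, β, ρ, with the following property. Let L ∈ ℤ, let a be measurable, supported in ½Q, with |a| ≤ 2^{(n+m)(1−L)} pointwise, and let k ≥ 1 be an integer such that ρ(k+L) < L. Then for every (x,y) ∈ Q_{k0}: |I a(x,y)| ≤ B · 2^{(k+L)(α−n)} · 2^{L(β−m)}. (No cancellation hypothesis on a is required.) -/

import Mathlib

open MeasureTheory

/-- The flag kernel `Ω(x,y) = |x|^(α-n) (|x|^ρ + |y|)^(β-m)` on `ℝ^n × ℝ^m`. -/
noncomputable def flagKernel (n m : ℕ) (α β ρ : ℝ)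
    (x : EuclideanSpace ℝ (Fin n)) (y : EuclideanSpace ℝ (Fin m)) : ℝ :=
  ‖x‖ ^ (α - (n : ℝ)) * (‖x‖ ^ ρ + ‖y‖) ^ (β - (m : ℝ))

/-- The fractional integral operator `I f(x,y) = ∬ f(u,v) Ω(x-u, y-v) du dv`. -/
noncomputable def flagOp (n m : ℕ) (α β ρ : ℝ)
    (f : EuclideanSpace ℝ (Fin n) × EuclideanSpace ℝ (Fin m) → ℝ)
    (z : EuclideanSpace ℝ (Fin n) × EuclideanSpace ℝ (Fin m)) : ℝ :=
  ∫ w : EuclideanSpace ℝ (Fin n) × EuclideanSpace ℝ (Fin m),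
    f w * flagKernel n m α β ρ (z.1 - w.1) (z.2 - w.2)

/-- The `ℓ^∞` (sup) norm `‖x‖_∞` of a point of Euclidean space. -/
noncomputable def supAbs {n : ℕ} (x : EuclideanSpace ℝ (Fin n)) : ℝ :=
  ‖(WithLp.equiv 2 (Fin n → ℝ)) x‖

open Set Metric Module

theorem supAbs_le_norm {n : ℕ} (x : EuclideanSpace ℝ (Fin n)) : supAbs x ≤ ‖x‖ :=
  (pi_norm_le_iff_of_nonneg (norm_nonneg x)).2 fun i => PiLp.norm_apply_le x i

theorem supAbs_nonneg {n : ℕ} (x : EuclideanSpace ℝ (Fin n)) : 0 ≤ supAbs x :=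
  norm_nonneg _

theorem norm_le_card_mul_supAbs {n : ℕ} (x : EuclideanSpace ℝ (Fin n)) :
    ‖x‖ ≤ n * supAbs x := by
  rcases Nat.eq_zero_or_pos n with rfl | hn
  · simp [EuclideanSpace.norm_eq]
  have hn' : (1 : ℝ) ≤ n := by exact_mod_cast hn
  have h0 := supAbs_nonneg x
  have hi : ∀ i, ‖x i‖ ^ 2 ≤ supAbs x ^ 2 := fun i =>
    pow_le_pow_left₀ (norm_nonneg _) (norm_le_pi_norm ((WithLp.equiv 2 (Fin n → ℝ)) x) i) 2
  rw [EuclideanSpace.norm_eq, Real.sqrt_le_iff]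
  refine ⟨by positivity, ?_⟩
  calc ∑ i, ‖x i‖ ^ 2 ≤ ∑ _i : Fin n, supAbs x ^ 2 := Finset.sum_le_sum fun i _ => hi i
    _ = n * supAbs x ^ 2 := by simp
    _ ≤ (n * supAbs x) ^ 2 := by
      rw [mul_pow]
      exact mul_le_mul_of_nonneg_right (by nlinarith) (by positivity)

theorem supAbs_sub_le {n : ℕ} (x u : EuclideanSpace ℝ (Fin n)) :
    supAbs (x - u) ≤ supAbs x + supAbs u :=
  norm_sub_le ((WithLp.equiv 2 (Fin n → ℝ)) x) ((WithLp.equiv 2 (Fin n → ℝ)) u)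

theorem supAbs_sub_supAbs_le {n : ℕ} (x u : EuclideanSpace ℝ (Fin n)) :
    supAbs x - supAbs u ≤ supAbs (x - u) :=
  norm_sub_norm_le ((WithLp.equiv 2 (Fin n → ℝ)) x) ((WithLp.equiv 2 (Fin n → ℝ)) u)

section NormRpow

variable {E : Type*} [NormedAddCommGroup E] [NormedSpace ℝ E] [FiniteDimensional ℝ E]
  [MeasurableSpace E] [BorelSpace E] (μ : Measure E) [μ.IsAddHaarMeasure]

theorem integrableOn_ball_norm_rpow_sub_finrank [Nontrivial E] {β : ℝ} (hβ : 0 < β)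
    {R : ℝ} (hR : 0 < R) :
    IntegrableOn (fun x : E => ‖x‖ ^ (β - finrank ℝ E)) (ball 0 R) μ := by
  rw [integrableOn_fun_norm_addHaar μ (f := fun t : ℝ => t ^ (β - finrank ℝ E))]
  have hd : 1 ≤ finrank ℝ E := finrank_pos
  refine ((intervalIntegral.integrableOn_Ioo_rpow_iff (s := β - 1) hR).2
    (by linarith)).congr_fun (fun t ht => ?_) measurableSet_Ioo
  simp only [smul_eq_mul]
  rw [← Real.rpow_natCast, ← Real.rpow_add ht.1]
  congr 1
  push_cast [hd]
  ring

theorem setIntegral_ball_norm_rpow_sub_finrank (β : ℝ) {R : ℝ} (hR : 0 < R) :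
    ∫ x in ball (0 : E) R, ‖x‖ ^ (β - finrank ℝ E) ∂μ =
      R ^ β * ∫ x in ball (0 : E) 1, ‖x‖ ^ (β - finrank ℝ E) ∂μ := by
  have h := Measure.setIntegral_comp_smul_of_pos μ
    (fun x : E => ‖x‖ ^ (β - finrank ℝ E)) (ball 0 1) hR
  have hR' : ∀ x : E, ‖R • x‖ ^ (β - finrank ℝ E) =
      R ^ (β - finrank ℝ E) * ‖x‖ ^ (β - finrank ℝ E) := fun x => by
    rw [norm_smul, Real.norm_of_nonneg hR.le, Real.mul_rpow hR.le (norm_nonneg x)]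
  simp only [hR', integral_const_mul] at h
  rw [smul_unitBall_of_pos hR, smul_eq_mul, Real.rpow_sub hR, Real.rpow_natCast] at h
  field_simp at h
  exact h.symm

end NormRpow

theorem flagKernel_le {n m : ℕ} {α β ρ : ℝ} (hα : α ≤ n) (hβ : β ≤ m) {t : ℝ} (ht : 0 < t)
    {x : EuclideanSpace ℝ (Fin n)} {y : EuclideanSpace ℝ (Fin m)} (hx : t ≤ ‖x‖) (hy : y ≠ 0) :
    flagKernel n m α β ρ x y ≤ t ^ (α - n) * ‖y‖ ^ (β - m) := by
  have hy' : 0 < ‖y‖ := norm_pos_iff.2 hy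
  refine mul_le_mul (Real.rpow_le_rpow_of_nonpos ht hx (by linarith))
    (Real.rpow_le_rpow_of_nonpos hy' ?_ (by linarith)) (by positivity) (by positivity)
  have : 0 ≤ ‖x‖ ^ ρ := by positivity
  linarith

theorem flagKernel_nonneg {n m : ℕ} {α β ρ : ℝ}
    (x : EuclideanSpace ℝ (Fin n)) (y : EuclideanSpace ℝ (Fin m)) :
    0 ≤ flagKernel n m α β ρ x y := by
  unfold flagKernel
  positivity

/-- Bound for `flagOp` at a point whose first component is at distance at least `t` from the
support of a bounded function. -/
theorem abs_flagOp_le {n m : ℕ} (hm : 0 < m) {α β ρ : ℝ} (hα : α ≤ n) (hβ : 0 < β)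
    (hβm : β ≤ m) {A t r R : ℝ} (hA : 0 ≤ A) (ht : 0 < t) (hr : 0 ≤ r) (hR : 0 < R)
    {a : EuclideanSpace ℝ (Fin n) × EuclideanSpace ℝ (Fin m) → ℝ} (ha : ∀ w, |a w| ≤ A)
    {z : EuclideanSpace ℝ (Fin n) × EuclideanSpace ℝ (Fin m)}
    (hsupp : ∀ w, a w ≠ 0 → ‖w.1‖ ≤ r ∧ t ≤ ‖z.1 - w.1‖ ∧ ‖z.2 - w.2‖ < R) :
    |flagOp n m α β ρ a z| ≤ A * t ^ (α - n) *
      ((r ^ n * volume.real (ball (0 : EuclideanSpace ℝ (Fin n)) 1)) *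
        (R ^ β * ∫ y in ball (0 : EuclideanSpace ℝ (Fin m)) 1, ‖y‖ ^ (β - m))) := by
  have : Nonempty (Fin m) := ⟨⟨0, hm⟩⟩
  have hint := integrableOn_ball_norm_rpow_sub_finrank
    (volume : Measure (EuclideanSpace ℝ (Fin m))) hβ hR
  have hval := setIntegral_ball_norm_rpow_sub_finrank
    (volume : Measure (EuclideanSpace ℝ (Fin m))) β hR
  simp only [finrank_euclideanSpace_fin] at hint hval
  set φ : EuclideanSpace ℝ (Fin n) → ℝ := (closedBall 0 r).indicator 1 with hφ
  set ψ : EuclideanSpace ℝ (Fin m) → ℝ := (ball 0 R).indicator fun y => ‖y‖ ^ (β - m) with hψ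
  have hφi : Integrable φ := (integrable_indicator_iff measurableSet_closedBall).2
    (integrableOn_const measure_closedBall_lt_top.ne)
  have hψi : Integrable ψ := (integrable_indicator_iff measurableSet_ball).2 hint
  have hφv : ∫ u, φ u = r ^ n * volume.real (ball (0 : EuclideanSpace ℝ (Fin n)) 1) := by
    rw [hφ, integral_indicator_one measurableSet_closedBall,
      Measure.addHaar_real_closedBall _ _ hr, finrank_euclideanSpace_fin]
  have hψv : ∫ v, ψ (z.2 - v) =
      R ^ β * ∫ y in ball (0 : EuclideanSpace ℝ (Fin m)) 1, ‖y‖ ^ (β - m) := by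
    rw [integral_sub_left_eq_self ψ volume z.2, hψ, integral_indicator measurableSet_ball, hval]
  have hφ0 : ∀ u, 0 ≤ φ u := fun u => indicator_nonneg (fun _ _ => zero_le_one) u
  have hψ0 : ∀ v, 0 ≤ ψ v := fun v => indicator_nonneg (fun _ _ => by positivity) v
  have hne : ∀ᵐ w : EuclideanSpace ℝ (Fin n) × EuclideanSpace ℝ (Fin m), w.2 ≠ z.2 :=
    Measure.quasiMeasurePreserving_snd.ae (Measure.ae_ne volume z.2)
  rw [← hφv, ← hψv, ← integral_prod_mul, ← integral_const_mul, flagOp,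
    ← Real.norm_eq_abs]
  refine norm_integral_le_of_norm_le
    ((hφi.mul_prod (hψi.comp_sub_left z.2)).const_mul (A * t ^ (α - n))) ?_
  filter_upwards [hne] with w hw
  by_cases haw : a w = 0
  · rw [haw, zero_mul, norm_zero]
    have := hφ0 w.1
    have := hψ0 (z.2 - w.2)
    positivity
  obtain ⟨h1, h2, h3⟩ := hsupp w haw
  have e1 : φ w.1 = 1 := indicator_of_mem (by simpa using h1) _
  have e2 : ψ (z.2 - w.2) = ‖z.2 - w.2‖ ^ (β - m) := indicator_of_mem (by simpa using h3) _
  rw [e1, e2, one_mul, norm_mul, Real.norm_eq_abs, Real.norm_of_nonneg (flagKernel_nonneg _ _),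
    mul_assoc]
  exact mul_le_mul (ha w) (flagKernel_le hα hβm ht h2 (sub_ne_zero.2 hw.symm))
    (flagKernel_nonneg _ _) hA

/-- Pointwise estimate in Case 3 when `ρ(k+L) < L`: on the shell `Q_{k0}`,
`|I a| ≤ B 2^{(k+L)(α-n)} 2^{L(β-m)}`; no cancellation on `a` is needed. -/
theorem flagOp_atom_pointwise_case3 (n m : ℕ) (hn : 0 < n) (hm : 0 < m) (α β ρ : ℝ)
    (hα : 0 < α) (hαn : α < n) (hβ : 0 < β) (hβm : β < m) (hρ : 1 ≤ ρ) :
    ∃ B : ℝ, 0 < B ∧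
      ∀ (L : ℤ) (a : EuclideanSpace ℝ (Fin n) × EuclideanSpace ℝ (Fin m) → ℝ),
        Measurable a →
        (∀ w, a w ≠ 0 → max (supAbs w.1) (supAbs w.2) ≤ (2 : ℝ) ^ (L - 2)) →
        (∀ w, |a w| ≤ (2 : ℝ) ^ (((n : ℤ) + m) * (1 - L))) →
        ∀ k : ℕ, 1 ≤ k → ρ * ((k : ℝ) + (L : ℝ)) < (L : ℝ) →
        ∀ w : EuclideanSpace ℝ (Fin n) × EuclideanSpace ℝ (Fin m),
          ((2 : ℝ) ^ (L + (k : ℤ) - 1) ≤ supAbs w.1 ∧ supAbs w.1 < (2 : ℝ) ^ (L + (k : ℤ))) →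
          supAbs w.2 < (2 : ℝ) ^ L →
          |flagOp n m α β ρ a w| ≤
            B * (2 : ℝ) ^ (((k : ℝ) + (L : ℝ)) * (α - n)) *
              (2 : ℝ) ^ ((L : ℝ) * (β - m)) := by
  set V := volume.real (ball (0 : EuclideanSpace ℝ (Fin n)) 1)
  set J := ∫ y in ball (0 : EuclideanSpace ℝ (Fin m)) 1, ‖y‖ ^ (β - m)
  have hV : 0 ≤ V := measureReal_nonneg
  have hJ : 0 ≤ J := integral_nonneg fun _ => by positivity
  set C := (2 : ℝ) ^ ((n : ℝ) + m - 2 * (α - n) - 2 * n + β) * (n ^ n * V) * (m ^ β * J) with hC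
  have hC0 : 0 ≤ C := by positivity
  refine ⟨C + 1, by positivity, ?_⟩
  intro L a _ hsupp ha k hk _ z hz1 hz2
  have hn' : (0 : ℝ) < n := by exact_mod_cast hn
  have hm' : (0 : ℝ) < m := by exact_mod_cast hm
  have key := abs_flagOp_le (z := z) (ρ := ρ) (A := (2 : ℝ) ^ (((n : ℤ) + m) * (1 - L)))
    (t := (2 : ℝ) ^ (L + (k : ℤ) - 2)) (r := n * (2 : ℝ) ^ (L - 2)) (R := m * (2 : ℝ) ^ (L + 1))
    hm hαn.le hβ hβm.le (by positivity) (by positivity) (by positivity) (by positivity) ha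
    (fun w hw => by
      obtain ⟨h1, h2⟩ := max_le_iff.1 (hsupp w hw)
      refine ⟨(norm_le_card_mul_supAbs _).trans (by gcongr), ?_, ?_⟩
      · refine le_trans ?_ ((supAbs_sub_supAbs_le z.1 w.1).trans (supAbs_le_norm _))
        have h3 : (2 : ℝ) ^ (L - 2) ≤ (2 : ℝ) ^ (L + (k : ℤ) - 2) :=
          zpow_le_zpow_right₀ one_le_two (by lia)
        have h4 : (2 : ℝ) ^ (L + (k : ℤ) - 1) = 2 * (2 : ℝ) ^ (L + (k : ℤ) - 2) := by
          rw [← zpow_one_add₀ two_ne_zero]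
          congr 1
          ring
        linarith [hz1.1]
      · refine (norm_le_card_mul_supAbs _).trans_lt (mul_lt_mul_of_pos_left ?_ hm')
        have h3 : (2 : ℝ) ^ (L - 2) ≤ (2 : ℝ) ^ L := zpow_le_zpow_right₀ one_le_two (by lia)
        have h4 : (2 : ℝ) ^ (L + 1) = (2 : ℝ) ^ L * 2 := zpow_add_one₀ two_ne_zero L
        linarith [supAbs_sub_le z.2 w.2])
  refine key.trans ?_
  calc _ = C * (2 : ℝ) ^ (((k : ℝ) + (L : ℝ)) * (α - n)) * (2 : ℝ) ^ ((L : ℝ) * (β - m)) := by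
        rw [mul_pow, Real.mul_rpow hm'.le (by positivity)]
        simp only [← Real.rpow_intCast]
        rw [← Real.rpow_mul_natCast zero_le_two, ← Real.rpow_mul zero_le_two,
          ← Real.rpow_mul zero_le_two]
        have e : (2 : ℝ) ^ (((((n : ℤ) + m) * (1 - L) : ℤ)) : ℝ) *
            (2 : ℝ) ^ (((L + (k : ℤ) - 2 : ℤ) : ℝ) * (α - n)) *
            (2 : ℝ) ^ (((L - 2 : ℤ) : ℝ) * n) * (2 : ℝ) ^ (((L + 1 : ℤ) : ℝ) * β) =
            (2 : ℝ) ^ ((n : ℝ) + m - 2 * (α - n) - 2 * n + β) *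
            (2 : ℝ) ^ (((k : ℝ) + (L : ℝ)) * (α - n)) * (2 : ℝ) ^ ((L : ℝ) * (β - m)) := by
          simp only [← Real.rpow_add two_pos]
          congr 1
          push_cast
          ring
        rw [hC]
        linear_combination (n ^ n * V * m ^ β * J) * e
    _ ≤ _ := by gcongr; linarith
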